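/- Let U be a finite group, G = U ≀ C₂, N = U × U, and H = {1,t}·{(u,u) : u ∈ U} ≤ G (so H ≅ C₂ × U). If χ is an irreducible complex character of G with ⟨χ_H, 1_H⟩ ≠ 0, then either χ = Ind_N^G(φ × φ̄) with φ ∈ Irr U, φ ≠ φ̄, or χ restricts to φ × φ on N with φ = φ̄ ∈ Irr U and χ(t·(u,v)) = ν₂(φ)·φ(uv). In both cases ⟨χ_H, 1_H⟩ = 1. In particular, the permutation character Ind_H^G(1) is multiplicity-free. -/

import Mathlib

/-- The coordinate-swap automorphism of `U × U`. -/
def swapAut (U : Type) [Group U] : MulAut (U × U) :=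
  { Equiv.prodComm U U with map_mul' := fun _ _ => rfl }

/-- The action of `C₂` on `U × U` by swapping coordinates. -/
def wrAct (U : Type) [Group U] : Multiplicative (ZMod 2) →* MulAut (U × U) where
  toFun x := if x.toAdd = 0 then 1 else swapAut U
  map_one' := by simp
  map_mul' := by
    intro x y
    have h2 : ∀ z : ZMod 2, z = 0 ∨ z = 1 := by decide
    have hsq : swapAut U * swapAut U = 1 := MulEquiv.ext fun _ => rfl
    rcases h2 x.toAdd with hx | hx <;> rcases h2 y.toAdd with hy | hy <;>
      simp [toAdd_mul, hx, hy, hsq, (by decide : (1 + 1 : ZMod 2) = 0)]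

/-- The wreath product `U ≀ C₂`: the semidirect product of `C₂ = {1,t}` acting on
`N = U × U` by swapping coordinates. -/
abbrev Wr (U : Type) [Group U] :=
  SemidirectProduct (U × U) (Multiplicative (ZMod 2)) (wrAct U)

/-- The swapping element `t` of `U ≀ C₂`. -/
def tEl (U : Type) [Group U] : Wr U := SemidirectProduct.inr (Multiplicative.ofAdd 1)

/-- `χ : G → ℂ` is a (complex) character of `G`. -/
def IsChar (G : Type) [Group G] (χ : G → ℂ) : Prop :=
  ∃ (V : Type) (_ : AddCommGroup V) (_ : Module ℂ V) (_ : FiniteDimensional ℂ V)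
    (τ : Representation ℂ G V), ∀ g, χ g = LinearMap.trace ℂ V (τ g)

/-- `χ : G → ℂ` is an irreducible complex character of `G`. -/
def IsIrrChar (G : Type) [Group G] (χ : G → ℂ) : Prop :=
  ∃ (V : Type) (_ : AddCommGroup V) (_ : Module ℂ V) (_ : FiniteDimensional ℂ V)
    (τ : Representation ℂ G V), Nontrivial V ∧
      (∀ W : Submodule ℂ V, (∀ g, ∀ x ∈ W, τ g x ∈ W) → W = ⊥ ∨ W = ⊤) ∧
      ∀ g, χ g = LinearMap.trace ℂ V (τ g)

/-- The character of `U ≀ C₂` induced from the character `φ × θ` of `N = U × U`. -/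
noncomputable def indChar {U : Type} [Group U] (φ θ : U → ℂ) : Wr U → ℂ :=
  fun g => (Nat.card (U × U) : ℂ)⁻¹ *
    ∑ᶠ x : Wr U, if (x * g * x⁻¹).right = 1
      then φ ((x * g * x⁻¹).left.1) * θ ((x * g * x⁻¹).left.2) else 0

/-- The subgroup `H = {1,t}·{(u,u) : u ∈ U}` of `U ≀ C₂`. -/
def Hdiag (U : Type) [Group U] : Subgroup (Wr U) :=
  Subgroup.closure ({tEl U} ∪ Set.range (fun u : U => SemidirectProduct.inl (u, u)))

section general
open Module
open scoped ComplexOrder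

theorem char_inv_conj {U W : Type} [Group U] [Finite U] [AddCommGroup W] [Module ℂ W]
    [FiniteDimensional ℂ W] (ρ : Representation ℂ U W) (g : U) :
    LinearMap.trace ℂ W (ρ g⁻¹) = (starRingEnd ℂ) (LinearMap.trace ℂ W (ρ g)) := by
  classical
  have := Fintype.ofFinite U
  let b := finBasis ℂ W
  let R : U → Matrix (Fin (finrank ℂ W)) (Fin (finrank ℂ W)) ℂ := fun x => LinearMap.toMatrix b b (ρ x)
  have hmul : ∀ x y, R (x * y) = R x * R y := by
    intro x y
    simp only [R, map_mul, LinearMap.toMatrix_mul]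
  have hone : R 1 = 1 := by simp [R]
  let P := ∑ x : U, (R x).conjTranspose * R x
  have hP : P.PosDef := by
    apply Matrix.posDef_sum ⟨1, Finset.mem_univ _⟩
    intro x _
    apply Matrix.PosDef.conjTranspose_mul_self
    intro v w hvw
    have := congrArg (fun z => (R x⁻¹).mulVec z) hvw
    simpa [Matrix.mulVec_mulVec, ← hmul, hone] using this
  have hinv : (R g).conjTranspose * P * R g = P := by
    simp only [P, Finset.mul_sum, Finset.sum_mul]
    refine Fintype.sum_equiv (Equiv.mulRight g) _ _ fun x => ?_
    simp [hmul, Matrix.conjTranspose_mul, Matrix.mul_assoc]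
  have hdet : IsUnit P.det := (Matrix.isUnit_iff_isUnit_det _).1 hP.isUnit
  have h1 : (R g).conjTranspose * P = P * R g⁻¹ := by
    calc (R g).conjTranspose * P = (R g).conjTranspose * P * (R g * R g⁻¹) := by
          rw [← hmul]; simp [hone]
      _ = ((R g).conjTranspose * P * R g) * R g⁻¹ := by simp only [Matrix.mul_assoc]
      _ = _ := by rw [hinv]
  have h2 : R g⁻¹ = P⁻¹ * ((R g).conjTranspose * P) := by
    rw [h1, ← Matrix.mul_assoc, Matrix.nonsing_inv_mul _ hdet, Matrix.one_mul]
  rw [LinearMap.trace_eq_matrix_trace ℂ b, LinearMap.trace_eq_matrix_trace ℂ b]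
  change (R g⁻¹).trace = _
  rw [h2, Matrix.trace_mul_comm, Matrix.mul_assoc, Matrix.mul_nonsing_inv _ hdet, Matrix.mul_one,
    Matrix.trace_conjTranspose]
  rfl

variable {U W : Type} [Group U] [AddCommGroup W] [Module ℂ W]
    [FiniteDimensional ℂ W] (ρ : Representation ℂ U W)

theorem schur_scalar [Nontrivial W]
    (hirr : ∀ K : Submodule ℂ W, (∀ g, ∀ x ∈ K, ρ g x ∈ K) → K = ⊥ ∨ K = ⊤)
    (B : W →ₗ[ℂ] W) (hB : ∀ g x, B (ρ g x) = ρ g (B x)) : ∃ c : ℂ, B = c • 1 := by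
  obtain ⟨c, hc⟩ := Module.End.exists_eigenvalue (K := ℂ) B
  refine ⟨c, ?_⟩
  rcases hirr (Module.End.eigenspace B c) (fun g x hx => by
    rw [Module.End.mem_eigenspace_iff] at hx ⊢
    rw [hB, hx, map_smul]) with h | h
  · exact absurd h hc
  · ext x
    have : x ∈ Module.End.eigenspace B c := by rw [h]; trivial
    simpa using Module.End.mem_eigenspace_iff.1 this

theorem schur_avg [Fintype U] [Nontrivial W]
    (hirr : ∀ K : Submodule ℂ W, (∀ g, ∀ x ∈ K, ρ g x ∈ K) → K = ⊥ ∨ K = ⊤)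
    (B : W →ₗ[ℂ] W) :
    (∑ x : U, ρ x * B * ρ x⁻¹) =
      ((Fintype.card U : ℂ) * LinearMap.trace ℂ W B / finrank ℂ W) • (1 : W →ₗ[ℂ] W) := by
  obtain ⟨c, hc⟩ := schur_scalar ρ hirr (∑ x : U, ρ x * B * ρ x⁻¹) (fun g y => by
    have : (∑ x : U, ρ x * B * ρ x⁻¹) * ρ g = ρ g * (∑ x : U, ρ x * B * ρ x⁻¹) := by
      simp only [Finset.mul_sum, Finset.sum_mul]
      refine Fintype.sum_equiv (Equiv.mulLeft g⁻¹) _ _ fun x => ?_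
      simp only [Equiv.coe_mulLeft, ← mul_assoc, ← map_mul]
      simp [mul_assoc, ← map_mul]
    exact congrArg (fun f => f y) this)
  have hd : (finrank ℂ W : ℂ) ≠ 0 := by exact_mod_cast (finrank_pos (R := ℂ) (M := W)).ne'
  have ht := congrArg (LinearMap.trace ℂ W) hc
  rw [map_sum, map_smul, LinearMap.trace_one] at ht
  have : ∀ x : U, LinearMap.trace ℂ W (ρ x * B * ρ x⁻¹) = LinearMap.trace ℂ W B := by
    intro x
    rw [LinearMap.trace_mul_comm, ← mul_assoc, ← map_mul]; simp
  simp only [this, Finset.sum_const, Finset.card_univ, nsmul_eq_mul, smul_eq_mul] at ht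
  rw [hc, ht]
  congr 1
  field_simp

theorem fourier_inv [Fintype U] [Nontrivial W]
    (hirr : ∀ K : Submodule ℂ W, (∀ g, ∀ x ∈ K, ρ g x ∈ K) → K = ⊥ ∨ K = ⊤)
    (A : W →ₗ[ℂ] W) :
    (∑ x : U, LinearMap.trace ℂ W (A * ρ x⁻¹) • ρ x) =
      ((Fintype.card U : ℂ) / finrank ℂ W) • A := by
  classical
  let L : (W →ₗ[ℂ] W) →ₗ[ℂ] (W →ₗ[ℂ] W) :=
    ∑ x : U, ((LinearMap.trace ℂ W) ∘ₗ (LinearMap.mulRight ℂ (ρ x⁻¹))).smulRight (ρ x)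
  have hL : ∀ A, L A = ∑ x : U, LinearMap.trace ℂ W (A * ρ x⁻¹) • ρ x := by
    intro A; simp [L]
  rw [← hL]
  have hrank : ∀ (l : Module.Dual ℂ W) (v : W), L (l.smulRight v) =
      ((Fintype.card U : ℂ) / finrank ℂ W) • (l.smulRight v) := by
    intro l v
    ext u
    have := congrArg (fun f => f v) (schur_avg ρ hirr (l.smulRight u))
    rw [hL]
    have h2 : ∀ x : U, LinearMap.trace ℂ W (l.smulRight v * ρ x⁻¹) = l (ρ x⁻¹ v) := by
      intro x
      have : l.smulRight v * ρ x⁻¹ = (l ∘ₗ ρ x⁻¹).smulRight v := by ext; simp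
      rw [this, LinearMap.trace_smulRight]; rfl
    simp only [LinearMap.trace_smulRight, LinearMap.sum_apply, Module.End.mul_apply, LinearMap.smulRight_apply, map_smul, LinearMap.smul_apply, Module.End.one_apply] at this
    simp only [h2, LinearMap.sum_apply, LinearMap.smul_apply, this, LinearMap.smulRight_apply]
    rw [smul_smul]; congr 1; ring
  have hA : A = ∑ i, ((finBasis ℂ W).coord i).smulRight (A (finBasis ℂ W i)) := by
    apply (finBasis ℂ W).ext
    intro j
    simp [Finsupp.single_apply]
  rw [hA, map_sum, Finset.smul_sum]
  exact Finset.sum_congr rfl fun i _ => hrank _ _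


/-- trace of `A ↦ ρ u A ρ v⁻¹`. -/
theorem trace_two_sided (u v : U) :
    LinearMap.trace ℂ (W →ₗ[ℂ] W) (LinearMap.mulLeft ℂ (ρ u) ∘ₗ LinearMap.mulRight ℂ (ρ v⁻¹))
      = LinearMap.trace ℂ W (ρ u) * LinearMap.trace ℂ W (ρ v⁻¹) := by
  have := Representation.char_linHom (G := U × U) (ρ.comp (MonoidHom.snd U U))
    (ρ.comp (MonoidHom.fst U U)) (u, v)
  rw [mul_comm]
  exact this


theorem exists_simple_quot {V : Type} [AddCommGroup V] [Module ℂ V] [FiniteDimensional ℂ V]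
    [Nontrivial V] (σ : Representation ℂ U V) :
    ∃ (W : Type) (_ : AddCommGroup W) (_ : Module ℂ W) (_ : FiniteDimensional ℂ W)
      (ρ : Representation ℂ U W) (p : V →ₗ[ℂ] W), Nontrivial W ∧
      (∀ K : Submodule ℂ W, (∀ g, ∀ x ∈ K, ρ g x ∈ K) → K = ⊥ ∨ K = ⊤) ∧
      Function.Surjective p ∧ ∀ g x, p (σ g x) = ρ g (p x) := by
  let S : Set (Submodule ℂ V) := {K | K ≠ ⊤ ∧ ∀ g, ∀ x ∈ K, σ g x ∈ K}
  have hS : S.Nonempty := ⟨⊥, bot_ne_top, fun g x hx => by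
    rw [Submodule.mem_bot] at hx ⊢; rw [hx, map_zero]⟩
  obtain ⟨K, hK, hmax⟩ := WellFounded.has_min
    (wellFounded_gt (α := Submodule ℂ V)) S hS
  refine ⟨V ⧸ K, inferInstance, inferInstance, inferInstance,
    σ.quotient K (fun g x hx => hK.2 g x hx), K.mkQ, ?_, ?_, K.mkQ_surjective, ?_⟩
  · exact Submodule.Quotient.nontrivial_iff.2 hK.1
  · intro L hL
    by_cases hLt : L = ⊤
    · exact Or.inr hLt
    · left
      have hmem : L.comap K.mkQ ∈ S := by
        refine ⟨fun h => hLt ?_, fun g x hx => ?_⟩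
        · rw [eq_top_iff]
          intro y _
          obtain ⟨x, rfl⟩ := K.mkQ_surjective y
          have : x ∈ L.comap K.mkQ := by rw [h]; trivial
          exact this
        · exact hL g _ hx
      have hle : K ≤ L.comap K.mkQ := by
        intro x hx
        simp [(Submodule.Quotient.mk_eq_zero K).2 hx]
      have heq : K = L.comap K.mkQ := by
        by_contra hne
        exact hmax _ hmem (lt_of_le_of_ne hle hne)
      rw [eq_bot_iff]
      intro y hy
      obtain ⟨x, rfl⟩ := K.mkQ_surjective y
      have : x ∈ K := by rw [heq]; exact hy
      simpa using this
  · intro g x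
    rfl

end general

set_option linter.unusedSectionVars false
section wreath
open Module

variable {U : Type} [Group U]

/-- The element `(u, v)` of the base group. -/
def nEl (u v : U) : Wr U := SemidirectProduct.inl (u, v)

theorem nEl_mul (a b c d : U) : nEl a b * nEl c d = nEl (a * c) (b * d) := by
  simp [nEl, ← map_mul]

theorem tEl_sq : tEl U * tEl U = 1 := by
  simp only [tEl, ← map_mul]
  rfl

theorem wrAct_swap (a b : U) : wrAct U (Multiplicative.ofAdd 1) (a, b) = (b, a) := rfl

theorem tEl_nEl (a b : U) : tEl U * nEl a b = nEl b a * tEl U := by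
  apply SemidirectProduct.ext
  · rw [SemidirectProduct.mul_left, SemidirectProduct.mul_left]
    simp [tEl, nEl, wrAct_swap]
  · simp [tEl, nEl]

theorem wr_cases (g : Wr U) : (∃ a b, g = nEl a b) ∨ ∃ a b, g = tEl U * nEl a b := by
  obtain ⟨⟨a, b⟩, s⟩ := g
  have h2 : ∀ z : ZMod 2, z = 0 ∨ z = 1 := by decide
  rcases h2 s.toAdd with h | h
  · left
    refine ⟨a, b, ?_⟩
    apply SemidirectProduct.ext
    · simp [nEl]
    · simpa [nEl] using h
  · right
    refine ⟨b, a, ?_⟩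
    apply SemidirectProduct.ext
    · rw [SemidirectProduct.mul_left]
      simp [tEl, nEl, wrAct_swap]
    · simp only [tEl, nEl, SemidirectProduct.mul_right, SemidirectProduct.right_inr,
        SemidirectProduct.right_inl, mul_one]
      exact h

variable {V : Type} [AddCommGroup V] [Module ℂ V] [FiniteDimensional ℂ V]
  (τ : Representation ℂ (Wr U) V) {W : Type} [AddCommGroup W] [Module ℂ W]
  [FiniteDimensional ℂ W] (ρ : Representation ℂ U W) [Fintype U] (w : V)

/-- The map `A ↦ ∑ x, tr (A ρ(x⁻¹)) (x,1) w`. -/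
noncomputable def Fmap : (W →ₗ[ℂ] W) →ₗ[ℂ] V :=
  ∑ x : U, ((LinearMap.trace ℂ W) ∘ₗ (LinearMap.mulRight ℂ (ρ x⁻¹))).smulRight (τ (nEl x 1) w)

theorem Fmap_apply (A : W →ₗ[ℂ] W) :
    Fmap τ ρ w A = ∑ x : U, LinearMap.trace ℂ W (A * ρ x⁻¹) • τ (nEl x 1) w := by
  simp [Fmap]


theorem nEl_e (hu : ∀ u, τ (nEl u u) w = w) (a b x : U) : τ (nEl a b) (τ (nEl x 1) w) = τ (nEl (a * x * b⁻¹) 1) w := by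
  conv_rhs => rw [← hu b]
  simp only [← Module.End.mul_apply, ← map_mul, nEl_mul]
  simp

theorem nEl_F (hu : ∀ u, τ (nEl u u) w = w) (a b : U) (A : W →ₗ[ℂ] W) :
    τ (nEl a b) (Fmap τ ρ w A) = Fmap τ ρ w (ρ a * A * ρ b⁻¹) := by
  rw [Fmap_apply, Fmap_apply, map_sum]
  refine Fintype.sum_equiv ((Equiv.mulLeft a).trans (Equiv.mulRight b⁻¹)) _ _ fun x => ?_
  rw [map_smul, nEl_e τ w hu]
  simp only [Equiv.trans_apply, Equiv.coe_mulLeft, Equiv.coe_mulRight]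
  congr 1
  have h : ρ a * A * ρ b⁻¹ * ρ (a * x * b⁻¹)⁻¹ = ρ a * (A * ρ (x⁻¹ * a⁻¹)) := by
    rw [mul_assoc, ← map_mul, mul_assoc]
    congr 3
    group
  rw [h, LinearMap.trace_mul_comm ℂ (ρ a), mul_assoc, ← map_mul, inv_mul_cancel_right]

theorem tEl_e (hu : ∀ u, τ (nEl u u) w = w) (ht : τ (tEl U) w = w) (x : U) : τ (tEl U) (τ (nEl x 1) w) = τ (nEl x⁻¹ 1) w := by
  rw [← Module.End.mul_apply, ← map_mul, tEl_nEl, map_mul, Module.End.mul_apply, ht]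
  conv_rhs => rw [← hu x]
  rw [← Module.End.mul_apply, ← map_mul, nEl_mul]
  simp

theorem tEl_F (hu : ∀ u, τ (nEl u u) w = w) (ht : τ (tEl U) w = w) (A : W →ₗ[ℂ] W) :
    τ (tEl U) (Fmap τ ρ w A) = ∑ x : U, LinearMap.trace ℂ W (A * ρ x) • τ (nEl x 1) w := by
  rw [Fmap_apply, map_sum]
  refine Fintype.sum_equiv (Equiv.inv U) _ _ fun x => ?_
  rw [map_smul, tEl_e τ w hu ht]
  simp

/-- `V` is spanned by the vectors `(x,1) w`. -/
theorem span_e (hu : ∀ u, τ (nEl u u) w = w) (ht : τ (tEl U) w = w) (hirrV : ∀ K : Submodule ℂ V, (∀ g, ∀ x ∈ K, τ g x ∈ K) → K = ⊥ ∨ K = ⊤)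
    (hw : w ≠ 0) (K : Submodule ℂ V) (hK : ∀ x : U, τ (nEl x 1) w ∈ K) : K = ⊤ := by
  have h := hirrV (Submodule.span ℂ (Set.range fun x : U => τ (nEl x 1) w)) (by
    intro g v hv
    have : Submodule.span ℂ (Set.range fun x : U => τ (nEl x 1) w) ≤
      (Submodule.span ℂ (Set.range fun x : U => τ (nEl x 1) w)).comap (τ g) := by
      rw [Submodule.span_le]
      rintro _ ⟨x, rfl⟩
      simp only [SetLike.mem_coe, Submodule.mem_comap]
      rcases wr_cases g with ⟨a, b, rfl⟩ | ⟨a, b, rfl⟩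
      · rw [nEl_e τ w hu]
        exact Submodule.subset_span ⟨_, rfl⟩
      · rw [map_mul, Module.End.mul_apply, nEl_e τ w hu, tEl_e τ w hu ht]
        exact Submodule.subset_span ⟨_, rfl⟩
    exact this hv)
  have hle : Submodule.span ℂ (Set.range fun x : U => τ (nEl x 1) w) ≤ K := by
    rw [Submodule.span_le]
    rintro _ ⟨x, rfl⟩
    exact hK x
  rcases h with h | h
  · exfalso
    apply hw
    have : w ∈ Submodule.span ℂ (Set.range fun x : U => τ (nEl x 1) w) := by
      apply Submodule.subset_span
      exact ⟨1, hu 1⟩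
    rw [h] at this
    simpa using this
  · rw [h] at hle
    exact top_le_iff.1 hle

variable [Nontrivial W]

theorem Fmap_injective 
    (hu : ∀ u, τ (nEl u u) w = w) (ht : τ (tEl U) w = w)
    (hirrV : ∀ K : Submodule ℂ V, (∀ g, ∀ x ∈ K, τ g x ∈ K) → K = ⊥ ∨ K = ⊤)
    (hw : w ≠ 0)
    (hirr : ∀ K : Submodule ℂ W, (∀ g, ∀ x ∈ K, ρ g x ∈ K) → K = ⊥ ∨ K = ⊤)
    (p : V →ₗ[ℂ] W) (hps : Function.Surjective p)
    (hp : ∀ u x, p (τ (nEl u 1) x) = ρ u (p x)) : Function.Injective (Fmap τ ρ w) := by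
  rw [← LinearMap.ker_eq_bot, LinearMap.ker_eq_bot']
  intro A hA
  have hd : (finrank ℂ W : ℂ) ≠ 0 := by exact_mod_cast (finrank_pos (R := ℂ) (M := W)).ne'
  have hc : (Fintype.card U : ℂ) ≠ 0 := by exact_mod_cast Fintype.card_ne_zero
  have hpF : ∀ B, p (Fmap τ ρ w B) = ((Fintype.card U : ℂ) / finrank ℂ W) • B (p w) := by
    intro B
    have := congrArg (fun f => f (p w)) (fourier_inv ρ hirr B)
    simp only [LinearMap.sum_apply, LinearMap.smul_apply] at this
    rw [← this, Fmap_apply, map_sum]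
    simp [hp]
  have h0 : ∀ b, A (ρ b (p w)) = 0 := by
    intro b
    have h1 := nEl_F τ ρ w hu 1 b⁻¹ A
    rw [hA, map_zero] at h1
    have h2 := hpF (ρ 1 * A * ρ b⁻¹⁻¹)
    rw [← h1, map_zero] at h2
    have h3 := smul_eq_zero.1 h2.symm
    rcases h3 with h3 | h3
    · exact absurd h3 (div_ne_zero hc hd)
    · simpa using h3
  have htop := span_e τ w hu ht hirrV hw (LinearMap.ker (A ∘ₗ p)) (by
    intro x
    simp [hp, h0])
  ext y
  obtain ⟨v, rfl⟩ := hps y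
  have : v ∈ LinearMap.ker (A ∘ₗ p) := by rw [htop]; trivial
  simpa using this

theorem F_commutant 
    (hu : ∀ u, τ (nEl u u) w = w) (ht : τ (tEl U) w = w)
    (hirrV : ∀ K : Submodule ℂ V, (∀ g, ∀ x ∈ K, τ g x ∈ K) → K = ⊥ ∨ K = ⊤)
    (hw : w ≠ 0)
    (hirr : ∀ K : Submodule ℂ W, (∀ g, ∀ x ∈ K, ρ g x ∈ K) → K = ⊥ ∨ K = ⊤)
    (p : V →ₗ[ℂ] W) (hps : Function.Surjective p)
    (hp : ∀ u x, p (τ (nEl u 1) x) = ρ u (p x)) (A : W →ₗ[ℂ] W)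
    (h : ∀ u, τ (nEl u u) (Fmap τ ρ w A) = Fmap τ ρ w A) : ∃ c : ℂ, A = c • 1 := by
  have hinj := Fmap_injective τ ρ w hu ht hirrV hw hirr p hps hp
  apply schur_scalar ρ hirr
  intro g x
  have h1 := h g
  rw [nEl_F τ ρ w hu] at h1
  have h2 := congrArg (fun f => f (ρ g x)) (hinj h1)
  simpa using h2.symm

theorem tEl_tEl (v : V) : τ (tEl U) (τ (tEl U) v) = v := by
  rw [← Module.End.mul_apply, ← map_mul, tEl_sq]; simp

/-- The Frobenius–Schur computation. -/
theorem fs_sum (hirr : ∀ K : Submodule ℂ W, (∀ g, ∀ x ∈ K, ρ g x ∈ K) → K = ⊥ ∨ K = ⊤) (g : U) :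
    ∑ x : U, LinearMap.trace ℂ W (ρ (x ^ 2 * g)) =
      (∑ x : U, LinearMap.trace ℂ W (ρ (x ^ 2))) / finrank ℂ W * LinearMap.trace ℂ W (ρ g) := by
  have hd : (finrank ℂ W : ℂ) ≠ 0 := by exact_mod_cast (finrank_pos (R := ℂ) (M := W)).ne'
  obtain ⟨c, hc⟩ := schur_scalar ρ hirr (∑ x : U, ρ (x ^ 2)) (fun g y => by
    have : (∑ x : U, ρ (x ^ 2)) * ρ g = ρ g * (∑ x : U, ρ (x ^ 2)) := by
      simp only [Finset.mul_sum, Finset.sum_mul]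
      refine Fintype.sum_equiv ((Equiv.mulLeft g⁻¹).trans (Equiv.mulRight g)) _ _ fun x => ?_
      simp only [Equiv.trans_apply, Equiv.coe_mulLeft, Equiv.coe_mulRight, ← map_mul]
      congr 1
      simp [pow_two, mul_assoc]
    exact congrArg (fun f => f y) this)
  have h1 := congrArg (LinearMap.trace ℂ W) hc
  rw [map_sum, map_smul, LinearMap.trace_one, smul_eq_mul] at h1
  have h2 := congrArg (fun f => LinearMap.trace ℂ W (f * ρ g)) hc
  simp only [Finset.sum_mul, map_sum, ← map_mul] at h2
  rw [h2, h1]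
  simp [hd]

theorem core 
    (hu : ∀ u, τ (nEl u u) w = w) (ht : τ (tEl U) w = w)
    (hirrV : ∀ K : Submodule ℂ V, (∀ g, ∀ x ∈ K, τ g x ∈ K) → K = ⊥ ∨ K = ⊤)
    (hw : w ≠ 0)
    (hirr : ∀ K : Submodule ℂ W, (∀ g, ∀ x ∈ K, ρ g x ∈ K) → K = ⊥ ∨ K = ⊤)
    (p : V →ₗ[ℂ] W) (hps : Function.Surjective p)
    (hp : ∀ u x, p (τ (nEl u 1) x) = ρ u (p x)) :
    (∃ v0 : V, ∀ v, τ (tEl U) v = v → (∀ u, τ (nEl u u) v = v) → ∃ c : ℂ, c • v0 = v) ∧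
    (((fun u => LinearMap.trace ℂ W (ρ u)) ≠ (fun u => LinearMap.trace ℂ W (ρ u⁻¹)) ∧
      (∀ u v, LinearMap.trace ℂ V (τ (nEl u v)) =
        LinearMap.trace ℂ W (ρ u) * LinearMap.trace ℂ W (ρ v⁻¹) +
        LinearMap.trace ℂ W (ρ v) * LinearMap.trace ℂ W (ρ u⁻¹)) ∧
      (∀ u v, LinearMap.trace ℂ V (τ (tEl U * nEl u v)) = 0)) ∨
     ((fun u => LinearMap.trace ℂ W (ρ u)) = (fun u => LinearMap.trace ℂ W (ρ u⁻¹)) ∧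
      (∀ u v, LinearMap.trace ℂ V (τ (nEl u v)) =
        LinearMap.trace ℂ W (ρ u) * LinearMap.trace ℂ W (ρ v)) ∧
      (∀ u v, LinearMap.trace ℂ V (τ (tEl U * nEl u v)) =
        ((Fintype.card U : ℂ)⁻¹ * ∑ x : U, LinearMap.trace ℂ W (ρ (x ^ 2))) *
          LinearMap.trace ℂ W (ρ (u * v))))) := by
  have hinj := Fmap_injective τ ρ w hu ht hirrV hw hirr p hps hp
  have hcomm := F_commutant τ ρ w hu ht hirrV hw hirr p hps hp
  have hN := nEl_F τ ρ w hu
  have htt := tEl_tEl τ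
  have htn : ∀ a b v, τ (tEl U) (τ (nEl a b) v) = τ (nEl b a) (τ (tEl U) v) := by
    intro a b v
    rw [← Module.End.mul_apply, ← map_mul, tEl_nEl, map_mul, Module.End.mul_apply]
  have hd : (finrank ℂ W : ℂ) ≠ 0 := by exact_mod_cast (finrank_pos (R := ℂ) (M := W)).ne'
  have hcU : (Fintype.card U : ℂ) ≠ 0 := by exact_mod_cast Fintype.card_ne_zero
  set F := Fmap τ ρ w with hF
  have hF1 : F 1 ≠ 0 := by
    intro h
    have : (1 : W →ₗ[ℂ] W) = 0 := hinj (by rw [h, map_zero])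
    exact one_ne_zero this
  let M : Submodule ℂ V := LinearMap.range F
  have hMN : ∀ a b, ∀ v ∈ M, τ (nEl a b) v ∈ M := by
    rintro a b _ ⟨A, rfl⟩
    exact ⟨_, (hN a b A).symm⟩
  let T : Submodule ℂ V := M.comap (τ (tEl U))
  have hTN : ∀ a b, ∀ v ∈ T, τ (nEl a b) v ∈ T := by
    intro a b v hv
    change τ (tEl U) (τ (nEl a b) v) ∈ M
    rw [htn]
    exact hMN _ _ _ hv
  have hMT : ∀ v ∈ M, τ (tEl U) v ∈ T := by
    intro v hv
    change τ (tEl U) (τ (tEl U) v) ∈ M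
    rwa [htt]
  have hTM : ∀ v ∈ T, τ (tEl U) v ∈ M := fun v hv => hv
  have hinf := hirrV (M ⊓ T) (by
    intro g v hv
    rcases wr_cases g with ⟨a, b, rfl⟩ | ⟨a, b, rfl⟩
    · exact ⟨hMN _ _ _ hv.1, hTN _ _ _ hv.2⟩
    · rw [map_mul, Module.End.mul_apply]
      exact ⟨hTM _ (hTN _ _ _ hv.2), hMT _ (hMN _ _ _ hv.1)⟩)
  have hsup : M ⊔ T = ⊤ := by
    have := hirrV (M ⊔ T) (by
      intro g v hv
      obtain ⟨x, hx, y, hy, rfl⟩ := Submodule.mem_sup.1 hv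
      rw [map_add]
      rcases wr_cases g with ⟨a, b, rfl⟩ | ⟨a, b, rfl⟩
      · exact Submodule.add_mem_sup (hMN _ _ _ hx) (hTN _ _ _ hy)
      · simp only [map_mul, Module.End.mul_apply]
        rw [add_comm]
        exact Submodule.add_mem_sup (hTM _ (hTN _ _ _ hy)) (hMT _ (hMN _ _ _ hx)))
    rcases this with h | h
    · exfalso
      apply hF1
      have h1 : F 1 ∈ M ⊔ T := Submodule.mem_sup_left ⟨1, rfl⟩
      rw [h] at h1
      simpa using h1
    · exact h
  rcases hinf with hinf | hinf
  · -- `V = M ⊕ tM`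
    let E : ((W →ₗ[ℂ] W) × (W →ₗ[ℂ] W)) →ₗ[ℂ] V := F.coprod (τ (tEl U) ∘ₗ F)
    have hE : ∀ A B, E (A, B) = F A + τ (tEl U) (F B) := fun A B => rfl
    have hEinj : Function.Injective E := by
      rw [← LinearMap.ker_eq_bot, LinearMap.ker_eq_bot']
      rintro ⟨A, B⟩ h
      rw [hE] at h
      have h1 : F A = - τ (tEl U) (F B) := eq_neg_of_add_eq_zero_left h
      have h2 : F A ∈ M ⊓ T := ⟨⟨A, rfl⟩, by rw [h1]; exact T.neg_mem (hMT _ ⟨B, rfl⟩)⟩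
      rw [hinf, Submodule.mem_bot] at h2
      rw [h2, zero_add] at h
      have h3 : F B = 0 := by rw [← htt (F B), h, map_zero]
      have hA : A = 0 := hinj (by rw [h2, map_zero])
      have hB : B = 0 := hinj (by rw [h3, map_zero])
      rw [hA, hB]; rfl
    have hEsurj : Function.Surjective E := by
      intro v
      have : v ∈ M ⊔ T := by rw [hsup]; trivial
      obtain ⟨_, ⟨A, rfl⟩, y, hy, rfl⟩ := Submodule.mem_sup.1 this
      obtain ⟨B, hB⟩ := hTM y hy
      refine ⟨(A, B), ?_⟩
      rw [hE, hB, htt]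
    let e := LinearEquiv.ofBijective E ⟨hEinj, hEsurj⟩
    have he : ∀ x, e x = E x := fun x => rfl
    refine ⟨⟨F 1 + τ (tEl U) (F 1), ?_⟩, Or.inl ⟨?_, ?_, ?_⟩⟩
    · intro v hv1 hv2
      obtain ⟨⟨A, B⟩, rfl⟩ := hEsurj v
      rw [hE, map_add, htt, ← hE, add_comm, ← hE] at hv1
      have hAB : B = A := congrArg Prod.fst (hEinj hv1)
      subst hAB
      obtain ⟨c, hc⟩ := hcomm B (by
        intro u
        have h := hv2 u
        rw [hE, map_add, ← htn, hN, ← hE, ← hE] at h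
        rw [hN]
        have : ρ u * B * ρ u⁻¹ = B := congrArg Prod.fst (hEinj h)
        rw [this])
      refine ⟨c, ?_⟩
      rw [hE, hc]
      simp
    · intro h
      have h1 : τ (tEl U) (F 1) = F 1 := by
        rw [hF, tEl_F τ ρ w hu ht, Fmap_apply]
        refine Finset.sum_congr rfl fun x _ => ?_
        have : LinearMap.trace ℂ W (ρ x) = LinearMap.trace ℂ W (ρ x⁻¹) := congrFun h x
        simp [this]
      have h2 : F 1 ∈ M ⊓ T := ⟨⟨1, rfl⟩, by rw [← h1]; exact hMT _ ⟨1, rfl⟩⟩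
      rw [hinf, Submodule.mem_bot] at h2
      exact hF1 h2
    · intro u v
      have h : τ (nEl u v) = e.conj (LinearMap.prodMap
          (LinearMap.mulLeft ℂ (ρ u) ∘ₗ LinearMap.mulRight ℂ (ρ v⁻¹))
          (LinearMap.mulLeft ℂ (ρ v) ∘ₗ LinearMap.mulRight ℂ (ρ u⁻¹))) := by
        ext x
        obtain ⟨⟨A, B⟩, rfl⟩ := e.surjective x
        rw [LinearEquiv.conj_apply_apply, e.symm_apply_apply, he, he, hE, map_add, ← htn, hN, hN]
        simp [hE, mul_assoc]
      rw [h, LinearMap.trace_conj', LinearMap.trace_prodMap', trace_two_sided, trace_two_sided]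
    · intro u v
      let f := LinearMap.mulLeft ℂ (ρ v) ∘ₗ LinearMap.mulRight ℂ (ρ u⁻¹)
      let g := LinearMap.mulLeft ℂ (ρ u) ∘ₗ LinearMap.mulRight ℂ (ρ v⁻¹)
      let i1 := LinearMap.inl ℂ (W →ₗ[ℂ] W) (W →ₗ[ℂ] W)
      let i2 := LinearMap.inr ℂ (W →ₗ[ℂ] W) (W →ₗ[ℂ] W)
      let p1 := LinearMap.fst ℂ (W →ₗ[ℂ] W) (W →ₗ[ℂ] W)
      let p2 := LinearMap.snd ℂ (W →ₗ[ℂ] W) (W →ₗ[ℂ] W)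
      have h : τ (tEl U * nEl u v) = e.conj (i1 ∘ₗ (f ∘ₗ p2) + i2 ∘ₗ (g ∘ₗ p1)) := by
        ext x
        obtain ⟨⟨A, B⟩, rfl⟩ := e.surjective x
        rw [LinearEquiv.conj_apply_apply, e.symm_apply_apply, he, he, hE, map_mul,
          Module.End.mul_apply, map_add, ← htn, hN, hN, map_add, htt]
        simp [hE, mul_assoc, i1, i2, p1, p2, f, g, add_comm]
      rw [h, LinearMap.trace_conj', map_add, LinearMap.trace_comp_comm' (f ∘ₗ p2) i1,
        LinearMap.trace_comp_comm' (g ∘ₗ p1) i2]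
      have h1 : (f ∘ₗ p2) ∘ₗ i1 = 0 := by
        apply LinearMap.ext; intro A
        change f 0 = 0
        exact map_zero f
      have h2 : (g ∘ₗ p1) ∘ₗ i2 = 0 := by
        apply LinearMap.ext; intro A
        change g 0 = 0
        exact map_zero g
      rw [h1, h2]; simp
  · -- `V = M = tM`
    have hFsurj : Function.Surjective F := by
      intro v
      have : v ∈ M ⊓ T := by rw [hinf]; trivial
      exact this.1
    let e := LinearEquiv.ofBijective F ⟨hinj, hFsurj⟩
    have he : ∀ x, e x = F x := fun x => rfl
    have htr : ∀ u v, LinearMap.trace ℂ V (τ (nEl u v)) =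
        LinearMap.trace ℂ W (ρ u) * LinearMap.trace ℂ W (ρ v⁻¹) := by
      intro u v
      have h : τ (nEl u v) = e.conj
          (LinearMap.mulLeft ℂ (ρ u) ∘ₗ LinearMap.mulRight ℂ (ρ v⁻¹)) := by
        ext x
        obtain ⟨A, rfl⟩ := e.surjective x
        rw [LinearEquiv.conj_apply_apply, e.symm_apply_apply, he, he, hN]
        simp [mul_assoc]
      rw [h, LinearMap.trace_conj', trace_two_sided]
    have hreal : ∀ u, LinearMap.trace ℂ W (ρ u) = LinearMap.trace ℂ W (ρ u⁻¹) := by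
      intro u
      have h1 : LinearMap.trace ℂ V (τ (nEl u 1)) = LinearMap.trace ℂ V (τ (nEl 1 u)) := by
        have : nEl 1 u = tEl U * (nEl u 1 * tEl U) := by
          rw [← tEl_nEl, ← mul_assoc, tEl_sq, one_mul]
        rw [this, map_mul, LinearMap.trace_mul_comm, ← map_mul, mul_assoc, tEl_sq, mul_one]
      rw [htr, htr] at h1
      simp only [inv_one, map_one, LinearMap.trace_one] at h1
      rw [mul_comm] at h1
      exact mul_left_cancel₀ hd h1
    obtain ⟨B, hB⟩ := hFsurj w
    obtain ⟨c, hc⟩ := hcomm B (by intro u; rw [hB, hu])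
    have hwc : w = c • F 1 := by rw [← hB, hc, map_smul]
    have hc0 : c ≠ 0 := by
      rintro rfl
      apply hw; rw [hwc, zero_smul]
    have hFρ : ∀ x, F (ρ x) = c⁻¹ • τ (nEl x 1) w := by
      intro x
      conv_rhs => rw [hwc, map_smul, hN, smul_smul, inv_mul_cancel₀ hc0, one_smul]
      simp
    have hTρ : ∀ x, τ (tEl U) (F (ρ x)) = F (ρ x⁻¹) := by
      intro x
      rw [hFρ, hFρ, map_smul, tEl_e τ w hu ht]
    let k : ℂ := (finrank ℂ W : ℂ) / Fintype.card U
    have hA : ∀ A : W →ₗ[ℂ] W, A = k • ∑ x : U, LinearMap.trace ℂ W (A * ρ x⁻¹) • ρ x := by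
      intro A
      rw [fourier_inv ρ hirr, smul_smul]
      have : k * ((Fintype.card U : ℂ) / finrank ℂ W) = 1 := by
        simp only [k]; field_simp
      rw [this, one_smul]
    have hTA : ∀ A : W →ₗ[ℂ] W, τ (tEl U) (F A) =
        F (k • ∑ x : U, LinearMap.trace ℂ W (A * ρ x⁻¹) • ρ x⁻¹) := by
      intro A
      conv_lhs => rw [hA A]
      simp only [map_smul, map_sum, hTρ]
    refine ⟨⟨F 1, ?_⟩, Or.inr ⟨funext hreal, ?_, ?_⟩⟩
    · intro v _ hv
      obtain ⟨A, rfl⟩ := hFsurj v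
      obtain ⟨c, hc⟩ := hcomm A hv
      exact ⟨c, by rw [hc, map_smul]⟩
    · intro u v
      rw [htr, ← hreal]
    · intro u v
      have h : τ (tEl U * nEl u v) = e.conj (k • ∑ x : U,
          (LinearMap.trace ℂ W ∘ₗ LinearMap.mulRight ℂ (ρ x⁻¹)).smulRight
            (ρ v * ρ x⁻¹ * ρ u⁻¹)) := by
        ext x
        obtain ⟨A, rfl⟩ := e.surjective x
        rw [LinearEquiv.conj_apply_apply, e.symm_apply_apply, he, he, tEl_nEl, map_mul,
          Module.End.mul_apply, hTA, hN]
        congr 1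
        simp only [LinearMap.smul_apply, LinearMap.sum_apply, LinearMap.smulRight_apply,
          LinearMap.comp_apply, LinearMap.mulRight_apply, mul_smul_comm, smul_mul_assoc,
          Finset.mul_sum, Finset.sum_mul]
      rw [h, LinearMap.trace_conj', map_smul, map_sum]
      have h3 : ∑ x : U, LinearMap.trace ℂ (W →ₗ[ℂ] W)
          ((LinearMap.trace ℂ W ∘ₗ LinearMap.mulRight ℂ (ρ x⁻¹)).smulRight
            (ρ v * ρ x⁻¹ * ρ u⁻¹)) =
          ∑ x : U, LinearMap.trace ℂ W (ρ (x ^ 2 * (u * v)⁻¹)) := by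
        refine Fintype.sum_equiv ((Equiv.inv U).trans (Equiv.mulRight v)) _ _ fun x => ?_
        rw [LinearMap.trace_smulRight]
        simp only [LinearMap.comp_apply, LinearMap.mulRight_apply, Equiv.trans_apply,
          Equiv.inv_apply, Equiv.coe_mulRight, ← map_mul]
        have e1 : (x⁻¹ * v) ^ 2 * (u * v)⁻¹ = x⁻¹ * (v * x⁻¹ * u⁻¹) := by
          simp [pow_two, mul_assoc]
        rw [e1, map_mul ρ, map_mul ρ x⁻¹, LinearMap.trace_mul_comm]
      rw [h3, fs_sum ρ hirr, ← hreal, smul_eq_mul]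
      simp only [k]
      field_simp

end wreath

section final
open Module
variable {U : Type} [Group U]

theorem nEl_inv (a b : U) : (nEl a b)⁻¹ = nEl a⁻¹ b⁻¹ := by
  rw [inv_eq_iff_mul_eq_one, nEl_mul]
  simp only [mul_inv_cancel]
  rfl

theorem tEl_inv : (tEl U)⁻¹ = tEl U := by
  rw [inv_eq_iff_mul_eq_one, tEl_sq]

theorem nEl_right (a b : U) : (nEl a b).right = 1 := rfl

theorem tEl_nEl_right (a b : U) : (tEl U * nEl a b).right ≠ 1 := by
  simp only [tEl, nEl, SemidirectProduct.mul_right, SemidirectProduct.right_inr,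
        SemidirectProduct.right_inl, mul_one]
  decide

theorem conj_right (x g : Wr U) : (x * g * x⁻¹).right = g.right := by
  simp only [SemidirectProduct.mul_right, SemidirectProduct.inv_right]
  rw [mul_comm, inv_mul_cancel_left]

theorem indChar_t [Finite U] (φ θ : U → ℂ) (u v : U) : indChar φ θ (tEl U * nEl u v) = 0 := by
  unfold indChar
  simp only [conj_right, tEl_nEl_right, if_false, finsum_zero, mul_zero]

theorem indChar_n [Finite U] (φ θ : U → ℂ) (hφ : ∀ a u, φ (a * u * a⁻¹) = φ u)
    (hθ : ∀ a u, θ (a * u * a⁻¹) = θ u) (u v : U) :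
    indChar φ θ (nEl u v) = φ u * θ v + φ v * θ u := by
  classical
  have := Fintype.ofFinite U
  unfold indChar
  simp only [conj_right, nEl_right, if_true]
  have h : ∀ x : Wr U, φ ((x * nEl u v * x⁻¹).left.1) * θ ((x * nEl u v * x⁻¹).left.2) =
      if x.right = 1 then φ u * θ v else φ v * θ u := by
    intro x
    rcases wr_cases x with ⟨a, b, rfl⟩ | ⟨a, b, rfl⟩
    · rw [nEl_inv, nEl_mul, nEl_mul, if_pos (nEl_right a b)]
      change φ (a * u * a⁻¹) * θ (b * v * b⁻¹) = _
      rw [hφ, hθ]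
    · have : tEl U * nEl a b * nEl u v * (tEl U * nEl a b)⁻¹ =
          nEl (b * v * b⁻¹) (a * u * a⁻¹) := by
        rw [mul_inv_rev, tEl_inv, nEl_inv, mul_assoc (tEl U), nEl_mul, ← mul_assoc,
          mul_assoc (tEl U), nEl_mul, tEl_nEl, mul_assoc, tEl_sq, mul_one]
      rw [this, if_neg (tEl_nEl_right a b)]
      change φ (b * v * b⁻¹) * θ (a * u * a⁻¹) = _
      rw [hφ, hθ]
  simp only [h]
  rw [← finsum_comp_equiv (SemidirectProduct.equivProd (φ := wrAct U)).symm,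
    finsum_eq_sum_of_fintype, Fintype.sum_prod_type]
  have h2 : (Finset.univ : Finset (Multiplicative (ZMod 2))) = {1, Multiplicative.ofAdd 1} := by
    decide
  have h3 : (Multiplicative.ofAdd 1 : Multiplicative (ZMod 2)) ≠ 1 := by decide
  have hc : (Fintype.card U : ℂ) ≠ 0 := by exact_mod_cast Fintype.card_ne_zero
  simp only [h2, Finset.sum_pair h3.symm, SemidirectProduct.equivProd, Equiv.coe_fn_symm_mk,
    if_true, h3, if_false, Finset.sum_const, Finset.card_univ, nsmul_eq_mul,
    Nat.card_eq_fintype_card, Fintype.card_prod, Nat.cast_mul]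
  field_simp

theorem tEl_mem : tEl U ∈ Hdiag U := Subgroup.subset_closure (Or.inl rfl)

theorem nEl_mem (u : U) : nEl u u ∈ Hdiag U := Subgroup.subset_closure (Or.inr ⟨u, rfl⟩)

theorem avg_eq [Finite U] {V : Type} [AddCommGroup V] [Module ℂ V] [FiniteDimensional ℂ V]
    (τ : Representation ℂ (Wr U) V) (χ : Wr U → ℂ) (hχ : ∀ g, χ g = LinearMap.trace ℂ V (τ g)) :
    (Nat.card (Hdiag U) : ℂ)⁻¹ * (∑ᶠ h : (Hdiag U), χ (h : Wr U)) =
      finrank ℂ (Representation.invariants (τ.comp (Hdiag U).subtype)) := by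
  classical
  have : Finite (Wr U) := Finite.of_equiv _ (SemidirectProduct.equivProd (φ := wrAct U)).symm
  have := Fintype.ofFinite (Hdiag U)
  have hne : (Nat.card (Hdiag U) : ℂ) ≠ 0 := by exact_mod_cast Nat.card_pos.ne'
  have := invertibleOfNonzero hne
  rw [← Representation.card_inv_mul_sum_char_eq_finrank, finsum_eq_sum_of_fintype]
  congr 1
  exact Finset.sum_congr rfl fun h _ => hχ h

theorem main_part {U : Type} [Group U] [Finite U] (χ : Wr U → ℂ) (hχ : IsIrrChar (Wr U) χ)
    (hne : (Nat.card (Hdiag U) : ℂ)⁻¹ * (∑ᶠ h : (Hdiag U), χ (h : Wr U)) ≠ 0) :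
      ((∃ φ : U → ℂ, IsIrrChar U φ ∧ φ ≠ (fun u => (starRingEnd ℂ) (φ u)) ∧
          χ = indChar φ (fun u => (starRingEnd ℂ) (φ u))) ∨
       (∃ φ : U → ℂ, IsIrrChar U φ ∧ φ = (fun u => (starRingEnd ℂ) (φ u)) ∧
          (∀ u v : U, χ (SemidirectProduct.inl (u, v)) = φ u * φ v) ∧
          (∀ u v : U, χ (tEl U * SemidirectProduct.inl (u, v))
            = ((Nat.card U : ℂ)⁻¹ * ∑ᶠ u : U, φ (u ^ 2)) * φ (u * v)))) ∧
      (Nat.card (Hdiag U) : ℂ)⁻¹ * (∑ᶠ h : (Hdiag U), χ (h : Wr U)) = 1 := by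
  obtain ⟨V, _, _, _, τ, hnt, hirrV, hχ⟩ := hχ
  have := Fintype.ofFinite U
  rw [avg_eq τ χ hχ] at hne ⊢
  set I := Representation.invariants (τ.comp (Hdiag U).subtype) with hI
  have hpos : 0 < finrank ℂ I := by
    apply Nat.pos_of_ne_zero
    exact_mod_cast hne
  have hntI : Nontrivial I := Module.nontrivial_of_finrank_pos hpos
  have hIt : ∀ v ∈ I, τ (tEl U) v = v := fun v hv => hv ⟨tEl U, tEl_mem⟩
  have hIu : ∀ v ∈ I, ∀ u, τ (nEl u u) v = v := fun v hv u => hv ⟨nEl u u, nEl_mem u⟩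
  obtain ⟨⟨w, hwI⟩, hw0⟩ := exists_ne (0 : I)
  have hw : w ≠ 0 := fun h => hw0 (Subtype.ext h)
  let j : U →* Wr U :=
    { toFun := fun u => nEl u 1
      map_one' := rfl
      map_mul' := fun a b => by rw [nEl_mul, mul_one] }
  obtain ⟨W, _, _, _, ρ, p, hW, hirr, hps, hp⟩ := exists_simple_quot (τ.comp j)
  obtain ⟨⟨v0, hv0⟩, hcase⟩ := core τ ρ w (hIu w hwI) (hIt w hwI) hirrV hw hirr p hps hp
  have hconj : ∀ u, LinearMap.trace ℂ W (ρ u⁻¹) =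
    (starRingEnd ℂ) (LinearMap.trace ℂ W (ρ u)) := char_inv_conj ρ
  have hcl : ∀ a u, LinearMap.trace ℂ W (ρ (a * u * a⁻¹)) = LinearMap.trace ℂ W (ρ u) :=
    fun a u => Representation.char_conj ρ u a
  have hφ : IsIrrChar U (fun u => LinearMap.trace ℂ W (ρ u)) :=
    ⟨W, inferInstance, inferInstance, inferInstance, ρ, hW, hirr, fun _ => rfl⟩
  refine ⟨?_, ?_⟩
  · simp only [hconj] at hcase
    rcases hcase with ⟨h1, h2, h3⟩ | ⟨h1, h2, h3⟩
    · left
      refine ⟨_, hφ, h1, ?_⟩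
      funext g
      rcases wr_cases g with ⟨a, b, rfl⟩ | ⟨a, b, rfl⟩
      · rw [hχ, h2, indChar_n]
        · exact hcl
        · intro a u
          simp only [hcl]
      · rw [hχ, h3, indChar_t]
    · right
      refine ⟨_, hφ, h1, ?_, ?_⟩
      · intro u v
        rw [hχ]
        exact h2 u v
      · intro u v
        rw [hχ, finsum_eq_sum_of_fintype, Nat.card_eq_fintype_card]
        exact h3 u v
  · have hle : finrank ℂ I ≤ 1 := by
      have hsub : I ≤ Submodule.span ℂ {v0} := by
        intro v hv
        obtain ⟨c, hc⟩ := hv0 v (hIt v hv) (hIu v hv)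
        exact Submodule.mem_span_singleton.2 ⟨c, hc⟩
      exact (Submodule.finrank_mono hsub).trans ((finrank_span_le_card {v0}).trans (by simp))
    have : finrank ℂ I = 1 := le_antisymm hle hpos
    rw [this, Nat.cast_one]

end final

/-- (Lemma `l:constpermchar`.) For `G = U ≀ C₂` and
`H = {1,t}{(u,u)}`: any irreducible complex character `χ` of `G` with
`⟨χ_H, 1_H⟩ ≠ 0` is either `Ind_N^G(φ × φ̄)` with `φ ≠ φ̄ ∈ Irr U`, or restricts to
`φ × φ` on `N` with `φ = φ̄` and `χ(t(u,v)) = ν₂(φ)·φ(uv)`; in both cases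
`⟨χ_H, 1_H⟩ = 1`.  In particular `Ind_H^G(1)` is multiplicity-free. -/
theorem stmt18 {U : Type} [Group U] [Finite U] :
    (∀ χ : Wr U → ℂ, IsIrrChar (Wr U) χ →
      (Nat.card (Hdiag U) : ℂ)⁻¹ * (∑ᶠ h : (Hdiag U), χ (h : Wr U)) ≠ 0 →
      ((∃ φ : U → ℂ, IsIrrChar U φ ∧ φ ≠ (fun u => (starRingEnd ℂ) (φ u)) ∧
          χ = indChar φ (fun u => (starRingEnd ℂ) (φ u))) ∨
       (∃ φ : U → ℂ, IsIrrChar U φ ∧ φ = (fun u => (starRingEnd ℂ) (φ u)) ∧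
          (∀ u v : U, χ (SemidirectProduct.inl (u, v)) = φ u * φ v) ∧
          (∀ u v : U, χ (tEl U * SemidirectProduct.inl (u, v))
            = ((Nat.card U : ℂ)⁻¹ * ∑ᶠ u : U, φ (u ^ 2)) * φ (u * v)))) ∧
      (Nat.card (Hdiag U) : ℂ)⁻¹ * (∑ᶠ h : (Hdiag U), χ (h : Wr U)) = 1) ∧
    -- in particular, the permutation character `Ind_H^G 1` is multiplicity-free:
    (∀ χ : Wr U → ℂ, IsIrrChar (Wr U) χ →
      (Nat.card (Hdiag U) : ℂ)⁻¹ * (∑ᶠ h : (Hdiag U), χ (h : Wr U)) = 0 ∨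
      (Nat.card (Hdiag U) : ℂ)⁻¹ * (∑ᶠ h : (Hdiag U), χ (h : Wr U)) = 1) := by
  refine ⟨fun χ hχ hne => main_part χ hχ hne, fun χ hχ => ?_⟩
  by_cases h : (Nat.card (Hdiag U) : ℂ)⁻¹ * (∑ᶠ h : (Hdiag U), χ (h : Wr U)) = 0
  · exact Or.inl h
  · exact Or.inr (main_part χ hχ h).2
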